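/- arXiv:2204.00927 — 2 statements merged into one kernel-verified Lean document; each statement's English description precedes it below -/
import Mathlib

section
/- Let l ≥ 2 be an integer, let {m_k} be an enumeration of the integers of D*(l), and let T = {t_{n,k}} be a summation method satisfying: for each n the family {t_{n,k} : k} has finitely many nonzero entries, |t_{n,k}| ≤ M for all n,k, and lim_{n→∞} t_{n,k} = 1 for each k. If real coefficients {a_k} are such that the sums ∑_k t_{n,k} a_k w_{m_k}(x) converge to zero as n → ∞ for every x in a measurable set E ⊂ (0,1) of measure |E| > 1 − 2^{−4l}, then a_k = 0 for all k. -/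
open MeasureTheory Filter Finset Topology

noncomputable section

/-- Rademacher function `r_n(x) = sign (sin (2^n π x))`. -/
def rademacher (n : ℕ) (x : ℝ) : ℝ := Real.sign (Real.sin (2 ^ n * Real.pi * x))

/-- Walsh function: for `m = 2^{k₁} + ⋯ + 2^{k_s}` (binary representation),
`w_m(x) = r_{k₁}(x) ⋯ r_{k_s}(x)`. -/
def walsh (m : ℕ) (x : ℝ) : ℝ :=
  ∏ k ∈ Finset.range (m + 1), if m.testBit k then rademacher k x else 1

/-- `D(s)`: positive integers `m = 2^{k₁} + ⋯ + 2^{k_s}` with `k₁ > ⋯ > k_s ≥ 1`. -/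
def DyadicSums (s : ℕ) : Set ℕ :=
  {m | ∃ k : Fin s → ℕ, StrictAnti k ∧ (∀ j, 1 ≤ k j) ∧ m = ∑ j, 2 ^ (k j)}

/-- `D*(l) = ⋃_{1 ≤ s ≤ l} D(s)`. -/
def DyadicStar (l : ℕ) : Set ℕ := ⋃ s ∈ Set.Icc 1 l, DyadicSums s


/-- product of Rademacher functions over a set of indices -/
def wProd (S : Finset ℕ) (x : ℝ) : ℝ := ∏ k ∈ S, rademacher k x

/-- polynomial in the Rademacher functions -/
def rPoly (U : Finset ℕ) (c : Finset ℕ → ℝ) (x : ℝ) : ℝ := ∑ S ∈ U.powerset, c S * wProd S x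

/-- Lebesgue measure on the unit interval -/
def muI : Measure ℝ := volume.restrict (Set.Ioc 0 1)

instance : IsFiniteMeasure muI := by unfold muI; infer_instance

/-- bounded measurable -/
def BM (g : ℝ → ℝ) : Prop := Measurable g ∧ ∃ C, ∀ x, |g x| ≤ C

lemma BM.integrable {g : ℝ → ℝ} (h : BM g) : Integrable g muI := by
  obtain ⟨h1, C, hC⟩ := h
  exact Integrable.of_bound h1.aestronglyMeasurable C (Eventually.of_forall hC)

lemma iadd {f g : ℝ → ℝ} (hf : Integrable f muI) (hg : Integrable g muI) :
    Integrable (fun x => f x + g x) muI := hf.add hg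

lemma BM.const (c : ℝ) : BM (fun _ => c) := ⟨measurable_const, |c|, fun _ => le_rfl⟩

lemma BM.add {f g : ℝ → ℝ} (hf : BM f) (hg : BM g) : BM (fun x => f x + g x) := by
  obtain ⟨h1, C, hC⟩ := hf
  obtain ⟨h2, D, hD⟩ := hg
  exact ⟨h1.add h2, C + D, fun x => (abs_add_le _ _).trans (add_le_add (hC x) (hD x))⟩

lemma BM.mul {f g : ℝ → ℝ} (hf : BM f) (hg : BM g) : BM (fun x => f x * g x) := by
  obtain ⟨h1, C, hC⟩ := hf
  obtain ⟨h2, D, hD⟩ := hg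
  refine ⟨h1.mul h2, C * D, fun x => ?_⟩
  rw [abs_mul]
  exact mul_le_mul (hC x) (hD x) (abs_nonneg _) ((abs_nonneg _).trans (hC x))

lemma BM.pow {f : ℝ → ℝ} (hf : BM f) (n : ℕ) : BM (fun x => f x ^ n) := by
  induction n with
  | zero => simpa using BM.const 1
  | succ n ih => simpa only [pow_succ] using ih.mul hf

lemma rad_cases (j : ℕ) (x : ℝ) :
    rademacher j x = -1 ∨ rademacher j x = 0 ∨ rademacher j x = 1 := by
  unfold rademacher
  exact Real.sign_apply_eq _

lemma rad_bm (j : ℕ) : BM (rademacher j) := by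
  refine ⟨?_, 1, fun x => ?_⟩
  · unfold rademacher
    have : Measurable Real.sign := by
      unfold Real.sign
      exact Measurable.ite measurableSet_Iio measurable_const
        (Measurable.ite measurableSet_Ioi measurable_const measurable_const)
    exact this.comp (by fun_prop)
  · rcases rad_cases j x with h | h | h <;> simp [h]

lemma rad_antiper (j : ℕ) (x : ℝ) : rademacher j (x + 1 / 2 ^ j) = - rademacher j x := by
  unfold rademacher
  have : (2 : ℝ) ^ j * Real.pi * (x + 1 / 2 ^ j) = 2 ^ j * Real.pi * x + Real.pi := by
    field_simp
  rw [this, Real.sin_add_pi, Real.sign_neg]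

lemma rad_per {j k : ℕ} (h : j < k) : Function.Periodic (rademacher k) (1 / 2 ^ j) := by
  have h1 : Function.Periodic (rademacher k) (2 * (1 / 2 ^ k)) := by
    intro x
    rw [two_mul, ← add_assoc, rad_antiper, rad_antiper, neg_neg]
  obtain ⟨d, rfl⟩ := Nat.exists_eq_add_of_lt h
  have h2 := h1.nat_mul (2 ^ d)
  have h3 : ((2 ^ d : ℕ) : ℝ) * (2 * (1 / 2 ^ (j + d + 1))) = 1 / 2 ^ j := by
    push_cast
    rw [pow_add, pow_add]
    field_simp
  rwa [h3] at h2

lemma rad_key {j : ℕ} (hj : 1 ≤ j) {g : ℝ → ℝ} (hp : Function.Periodic g (1 / 2 ^ j)) :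
    ∫ x, g x * rademacher j x ∂muI = 0 := by
  unfold muI
  rw [← intervalIntegral.integral_of_le zero_le_one]
  set f : ℝ → ℝ := fun x => g x * rademacher j x with hf
  have ha : ∀ x, f (x + 1 / 2 ^ j) = - f x := by
    intro x
    simp only [hf]
    rw [hp x, rad_antiper]; ring
  have hper : Function.Periodic f 1 := by
    have h1 : Function.Periodic f (2 * (1 / 2 ^ j)) := by
      intro x
      rw [two_mul, ← add_assoc, ha, ha, neg_neg]
    obtain ⟨d, rfl⟩ := Nat.exists_eq_add_of_le hj
    have h2 := h1.nat_mul (2 ^ d)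
    have h3 : ((2 ^ d : ℕ) : ℝ) * (2 * (1 / 2 ^ (1 + d))) = 1 := by
      push_cast
      rw [pow_add]
      field_simp
    rwa [h3] at h2
  have h1 := hper.intervalIntegral_add_eq (1 / 2 ^ j) 0
  have h2 : ∫ x in (0:ℝ)..1, f (x + 1 / 2 ^ j) = ∫ x in (0 + 1 / 2 ^ j : ℝ)..(1 + 1 / 2 ^ j), f x :=
    intervalIntegral.integral_comp_add_right f _
  simp only [ha, intervalIntegral.integral_neg] at h2
  rw [zero_add, add_comm (1:ℝ), h1, zero_add] at h2
  linarith

lemma rad_ae (j : ℕ) : ∀ᵐ x ∂muI, rademacher j x ^ 2 = 1 := by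
  have hc : {x : ℝ | ¬ rademacher j x ^ 2 = 1} ⊆ Set.range (fun n : ℤ => (n : ℝ) / 2 ^ j) := by
    intro x hx
    have h0 : rademacher j x = 0 := by
      rcases rad_cases j x with h | h | h
      · simp [h] at hx
      · exact h
      · simp [h] at hx
    unfold rademacher at h0
    rw [Real.sign_eq_zero_iff, Real.sin_eq_zero_iff] at h0
    obtain ⟨n, hn⟩ := h0
    refine ⟨n, ?_⟩
    have := Real.pi_ne_zero
    simp only
    field_simp
    apply mul_right_cancel₀ this
    linarith
  have : volume {x : ℝ | ¬ rademacher j x ^ 2 = 1} = 0 :=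
    ((Set.countable_range _).mono hc).measure_zero _
  exact ae_restrict_of_ae (ae_iff.2 this)

lemma rad_sq (j : ℕ) (g : ℝ → ℝ) :
    ∫ x, g x * rademacher j x ^ 2 ∂muI = ∫ x, g x ∂muI := by
  apply integral_congr_ae
  filter_upwards [rad_ae j] with x hx
  rw [hx, mul_one]

lemma wProd_bm (S : Finset ℕ) : BM (wProd S) := by
  induction S using Finset.induction_on with
  | empty =>
    have : wProd ∅ = fun _ => 1 := by funext x; simp [wProd]
    rw [this]; exact BM.const 1
  | insert a s ha ih =>
    have : wProd (insert a s) = fun x => rademacher a x * wProd s x := by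
      funext x; simp [wProd, Finset.prod_insert ha]
    rw [this]
    exact (rad_bm a).mul ih

lemma rPoly_bm (U : Finset ℕ) (c : Finset ℕ → ℝ) : BM (rPoly U c) := by
  unfold rPoly
  induction U.powerset using Finset.induction_on with
  | empty => simpa using BM.const 0
  | insert a s ha ih =>
    simp only [Finset.sum_insert ha]
    exact ((BM.const _).mul (wProd_bm a)).add ih

lemma rPoly_per {U : Finset ℕ} {j : ℕ} (h : ∀ k ∈ U, j < k) (c : Finset ℕ → ℝ) :
    Function.Periodic (rPoly U c) (1 / 2 ^ j) := by
  intro x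
  unfold rPoly wProd
  refine Finset.sum_congr rfl fun S hS => ?_
  congr 1
  refine Finset.prod_congr rfl fun k hk => ?_
  exact rad_per (h k (Finset.mem_powerset.1 hS hk)) x

lemma rPoly_insert {U : Finset ℕ} {j : ℕ} (h : j ∉ U) (c : Finset ℕ → ℝ) (x : ℝ) :
    rPoly (insert j U) c x = rPoly U c x + rPoly U (fun S => c (insert j S)) x * rademacher j x := by
  unfold rPoly
  rw [Finset.sum_powerset_insert h, Finset.sum_mul]
  congr 1
  refine Finset.sum_congr rfl fun S hS => ?_
  have : j ∉ S := fun hh => h (Finset.mem_powerset.1 hS hh)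
  rw [wProd, Finset.prod_insert this, wProd]; ring

/-- sum of squares of coefficients -/
def qSum (U : Finset ℕ) (c : Finset ℕ → ℝ) : ℝ := ∑ S ∈ U.powerset, c S ^ 2

lemma qSum_insert {U : Finset ℕ} {j : ℕ} (h : j ∉ U) (c : Finset ℕ → ℝ) :
    qSum (insert j U) c = qSum U c + qSum U (fun S => c (insert j S)) := by
  unfold qSum
  rw [Finset.sum_powerset_insert h]

lemma qSum_nonneg (U : Finset ℕ) (c : Finset ℕ → ℝ) : 0 ≤ qSum U c :=
  Finset.sum_nonneg fun _ _ => sq_nonneg _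

lemma muI_one : muI.real Set.univ = 1 := by
  simp [muI, Measure.real]

lemma parseval (U : Finset ℕ) : (∀ k ∈ U, 1 ≤ k) → ∀ (c : Finset ℕ → ℝ),
    ∫ x, rPoly U c x ^ 2 ∂muI = qSum U c := by
  induction U using Finset.induction_on_min with
  | empty => intro _ c; simp [rPoly, qSum, wProd, muI_one]
  | insert j U hj ih =>
    intro hU c
    have hjU : j ∉ U := fun h => lt_irrefl _ (hj j h)
    have hU' : ∀ k ∈ U, 1 ≤ k := fun k hk => hU k (Finset.mem_insert_of_mem hk)
    set c' : Finset ℕ → ℝ := fun S => c (insert j S) with hc'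
    set A := rPoly U c with hA
    set B := rPoly U c' with hB
    have bA : BM A := rPoly_bm _ _
    have bB : BM B := rPoly_bm _ _
    have br := rad_bm j
    have pA : Function.Periodic A (1 / 2 ^ j) := rPoly_per hj c
    have pB : Function.Periodic B (1 / 2 ^ j) := rPoly_per hj c'
    have e : ∀ x, rPoly (insert j U) c x ^ 2 =
        (A x ^ 2 + (2 * A x * B x) * rademacher j x) + B x ^ 2 * rademacher j x ^ 2 := by
      intro x
      rw [rPoly_insert hjU]; ring
    have i1 := (bA.pow 2).integrable
    have i2 := ((((BM.const 2).mul bA).mul bB).mul br).integrable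
    have i3 := ((bB.pow 2).mul (br.pow 2)).integrable
    simp only [e]
    rw [integral_add (iadd i1 i2) i3, integral_add i1 i2, rad_sq,
      rad_key (hU j (Finset.mem_insert_self _ _)) (g := fun x => 2 * A x * B x)
        (by intro x; simp only [pA x, pB x]), ih hU', ih hU', qSum_insert hjU]
    ring

lemma cs_int {f g : ℝ → ℝ} (hf : BM f) (hg : BM g) :
    (∫ x, f x * g x ∂muI) ^ 2 ≤ (∫ x, f x ^ 2 ∂muI) * ∫ x, g x ^ 2 ∂muI := by
  have h : ∀ s : ℝ, 0 ≤ (∫ x, f x ^ 2 ∂muI) * (s * s) + (2 * ∫ x, f x * g x ∂muI) * s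
      + ∫ x, g x ^ 2 ∂muI := by
    intro s
    have h0 : 0 ≤ ∫ x, (s * f x + g x) ^ 2 ∂muI := integral_nonneg fun x => sq_nonneg _
    have e : ∀ x, (s * f x + g x) ^ 2 =
      ((s * s) * f x ^ 2 + (2 * s) * (f x * g x)) + g x ^ 2 := by intro x; ring
    simp only [e] at h0
    have i1 := (hf.pow 2).integrable.const_mul (s * s)
    have i2 := (hf.mul hg).integrable.const_mul (2 * s)
    rw [integral_add (iadd i1 i2) (hg.pow 2).integrable, integral_add i1 i2,
      integral_const_mul, integral_const_mul] at h0
    linarith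
  have := discrim_le_zero h
  unfold discrim at this
  linarith

lemma bonami (U : Finset ℕ) : (∀ k ∈ U, 1 ≤ k) → ∀ (l : ℕ) (c : Finset ℕ → ℝ),
    (∀ S, l < S.card → c S = 0) →
    ∫ x, rPoly U c x ^ 4 ∂muI ≤ 9 ^ l * qSum U c ^ 2 := by
  induction U using Finset.induction_on_min with
  | empty =>
    intro _ l c _
    simp only [rPoly, qSum, wProd, Finset.powerset_empty, Finset.sum_singleton,
      Finset.prod_empty, mul_one, integral_const, muI_one, one_smul]
    have : (1 : ℝ) ≤ 9 ^ l := one_le_pow₀ (by norm_num)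
    nlinarith [sq_nonneg (c ∅ ^ 2)]
  | insert j U hj ih =>
    intro hU l c hc
    have hjU : j ∉ U := fun h => lt_irrefl _ (hj j h)
    have hU' : ∀ k ∈ U, 1 ≤ k := fun k hk => hU k (Finset.mem_insert_of_mem hk)
    set c' : Finset ℕ → ℝ := fun S => if j ∈ S then 0 else c (insert j S) with hc'
    have hpc : rPoly U (fun S => c (insert j S)) = rPoly U c' := by
      funext x
      refine Finset.sum_congr rfl fun S hS => ?_
      have : j ∉ S := fun hh => hjU (Finset.mem_powerset.1 hS hh)
      simp [hc', this]
    have hqc : qSum U (fun S => c (insert j S)) = qSum U c' := by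
      refine Finset.sum_congr rfl fun S hS => ?_
      have : j ∉ S := fun hh => hjU (Finset.mem_powerset.1 hS hh)
      simp [hc', this]
    cases l with
    | zero =>
      have h0 : c' = fun _ => 0 := by
        funext S
        simp only [hc']
        split_ifs with h
        · rfl
        · exact hc _ (by simp [Finset.card_insert_of_notMem h])
      have := ih hU' 0 c hc
      simp only [rPoly_insert hjU, qSum_insert hjU, hpc, hqc, h0]
      simpa [rPoly, qSum] using this
    | succ l =>
      have hcl : ∀ S, l < S.card → c' S = 0 := by
        intro S hS
        simp only [hc']
        split_ifs with h
        · rfl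
        · exact hc _ (by rw [Finset.card_insert_of_notMem h]; omega)
      have hA4 := ih hU' (l + 1) c hc
      have hB4 := ih hU' l c' hcl
      rw [qSum_insert hjU, hqc]
      have qa := qSum_nonneg U c
      have qb := qSum_nonneg U c'
      set a := qSum U c
      set b := qSum U c'
      set A := rPoly U c with hA
      set B := rPoly U c' with hB
      have bA : BM A := rPoly_bm _ _
      have bB : BM B := rPoly_bm _ _
      have br := rad_bm j
      have pA : Function.Periodic A (1 / 2 ^ j) := rPoly_per hj c
      have pB : Function.Periodic B (1 / 2 ^ j) := rPoly_per hj c'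
      have e : ∀ x, rPoly (insert j U) c x ^ 4 =
          ((A x ^ 4 + (4 * A x ^ 3 * B x + 4 * A x * B x ^ 3) * rademacher j x)
           + (6 * (A x ^ 2 * B x ^ 2)) * rademacher j x ^ 2)
           + (B x ^ 4 * rademacher j x ^ 2) * rademacher j x ^ 2 := by
        intro x
        have h3 : rademacher j x ^ 3 = rademacher j x := by
          rcases rad_cases j x with h | h | h <;> rw [h] <;> norm_num
        rw [rPoly_insert hjU, hpc]
        linear_combination (4 * A x * B x ^ 3) * h3
      have i1 := (bA.pow 4).integrable
      have i2 := (((((BM.const 4).mul (bA.pow 3)).mul bB).add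
        (((BM.const 4).mul bA).mul (bB.pow 3))).mul br).integrable
      have i3 := (((BM.const 6).mul ((bA.pow 2).mul (bB.pow 2))).mul (br.pow 2)).integrable
      have i4 := (((bB.pow 4).mul (br.pow 2)).mul (br.pow 2)).integrable
      simp only [e]
      rw [integral_add (iadd (iadd i1 i2) i3) i4, integral_add (iadd i1 i2) i3, integral_add i1 i2,
        rad_sq, rad_sq, rad_sq, integral_const_mul,
        rad_key (hU j (Finset.mem_insert_self _ _))
          (g := fun x => 4 * A x ^ 3 * B x + 4 * A x * B x ^ 3)
          (by intro x; simp only [pA x, pB x])]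
      have cs := cs_int (bA.pow 2) (bB.pow 2)
      simp only [← pow_mul] at cs
      norm_num at cs
      set X := ∫ x, A x ^ 4 ∂muI
      set Y := ∫ x, B x ^ 4 ∂muI
      set Z := ∫ x, A x ^ 2 * B x ^ 2 ∂muI
      have hY : 0 ≤ Y := integral_nonneg fun x => by positivity
      have hZ : Z ≤ 3 * 9 ^ l * a * b := by
        apply abs_le_of_sq_le_sq' ?_ (by positivity) |>.2
        calc Z ^ 2 ≤ X * Y := cs
          _ ≤ (9 ^ (l + 1) * a ^ 2) * (9 ^ l * b ^ 2) :=
            mul_le_mul hA4 hB4 hY (by positivity)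
          _ = _ := by rw [pow_succ]; ring
      have h9 : (0:ℝ) < 9 ^ l := by positivity
      rw [pow_succ] at *
      nlinarith [mul_nonneg h9.le (sq_nonneg b)]

lemma small_q {U : Finset ℕ} (hU : ∀ k ∈ U, 1 ≤ k) {l : ℕ} (hl : 2 ≤ l) (c : Finset ℕ → ℝ)
    (hc : ∀ S, l < S.card → c S = 0) {ε : ℝ} (hε : 0 < ε) {F : Set ℝ} (hF : MeasurableSet F)
    (hFm : muI.real F ≤ 1 / 16 ^ l) (h : ∀ x, x ∉ F → rPoly U c x ^ 2 ≤ ε) :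
    qSum U c ≤ 16 / 7 * ε := by
  have h4 := bonami U hU l c hc
  have h2 := parseval U hU c
  have hQ0 := qSum_nonneg U c
  set Q := qSum U c
  rcases hQ0.eq_or_lt with h0 | hQ
  · rw [← h0]; positivity
  set P := rPoly U c
  have bP : BM P := rPoly_bm U c
  set s : ℝ := 12 ^ l * Q with hs
  have hsp : 0 < s := by positivity
  have bF : BM (F.indicator (fun _ => (1:ℝ))) := by
    refine ⟨measurable_const.indicator hF, 1, fun x => ?_⟩
    by_cases hx : x ∈ F <;> simp [hx]
  have pw : ∀ x, P x ^ 2 ≤ ε + (s / 2 * F.indicator (fun _ => (1:ℝ)) x + 1 / (2 * s) * P x ^ 4) := by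
    intro x
    by_cases hx : x ∈ F
    · simp only [hx, Set.indicator_of_mem, mul_one]
      have : s / 2 + 1 / (2 * s) * P x ^ 4 - P x ^ 2 = (s - P x ^ 2) ^ 2 / (2 * s) := by
        field_simp; ring
      have h5 : 0 ≤ (s - P x ^ 2) ^ 2 / (2 * s) := by positivity
      linarith
    · simp only [hx, not_false_eq_true, Set.indicator_of_notMem, mul_zero]
      have := h x hx
      have : 0 ≤ 1 / (2 * s) * P x ^ 4 := by positivity
      linarith
  have hind : ∫ x, F.indicator (fun _ => (1:ℝ)) x ∂muI = muI.real F := integral_indicator_one hF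
  have i1 := bF.integrable.const_mul (s / 2)
  have i2 := (bP.pow 4).integrable.const_mul (1 / (2 * s))
  have hi := integral_mono (bP.pow 2).integrable (iadd (BM.const ε).integrable (iadd i1 i2)) pw
  rw [integral_add (BM.const ε).integrable (iadd i1 i2), integral_add i1 i2, integral_const_mul,
    integral_const_mul, hind, integral_const, muI_one, one_smul, h2] at hi
  have e1 : s / 2 * muI.real F ≤ (3 / 4) ^ l * Q / 2 := by
    calc s / 2 * muI.real F ≤ s / 2 * (1 / 16 ^ l) := by gcongr
      _ = (12 ^ l / 16 ^ l) * Q / 2 := by rw [hs]; ring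
      _ = _ := by rw [← div_pow]; norm_num
  have e2 : 1 / (2 * s) * ∫ x, P x ^ 4 ∂muI ≤ (3 / 4) ^ l * Q / 2 := by
    calc 1 / (2 * s) * ∫ x, P x ^ 4 ∂muI ≤ 1 / (2 * s) * (9 ^ l * Q ^ 2) := by gcongr
      _ = (9 ^ l / 12 ^ l) * Q / 2 := by rw [hs]; field_simp
      _ = _ := by rw [← div_pow]; norm_num
  have e3 : ((3:ℝ) / 4) ^ l ≤ 9 / 16 := by
    calc ((3:ℝ) / 4) ^ l ≤ (3 / 4) ^ 2 := pow_le_pow_of_le_one (by norm_num) (by norm_num) hl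
      _ = _ := by norm_num
  nlinarith

/-- the set of binary digits -/
def bitSet (m : ℕ) : Finset ℕ := m.bitIndices.toFinset

lemma walsh_eq (m : ℕ) (x : ℝ) : walsh m x = wProd (bitSet m) x := by
  unfold walsh wProd
  rw [← Finset.prod_filter]
  refine Finset.prod_congr ?_ fun _ _ => rfl
  ext k
  simp only [bitSet, Finset.mem_filter, Finset.mem_range, List.mem_toFinset, Nat.mem_bitIndices,
    and_iff_right_iff_imp]
  intro h
  have h1 := Nat.ge_two_pow_of_testBit h
  have h2 : k < 2 ^ k := Nat.lt_two_pow_self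
  omega

lemma bitSet_inj : Function.Injective bitSet := by
  intro a b h
  rw [← Finset.sum_toFinset_bitIndices_two_pow a, ← Finset.sum_toFinset_bitIndices_two_pow b]
  unfold bitSet at h
  rw [h]

lemma bitSet_star {l m : ℕ} (h : m ∈ DyadicStar l) :
    (bitSet m).card ≤ l ∧ ∀ k ∈ bitSet m, 1 ≤ k := by
  simp only [DyadicStar, Set.mem_iUnion, DyadicSums, Set.mem_Icc] at h
  obtain ⟨s, ⟨_, hs⟩, k, hk, hk1, hm⟩ := h
  have : bitSet m = Finset.univ.image k := by
    rw [hm, ← Finset.sum_image (g := k) (f := fun i => 2 ^ i) (fun a _ b _ hab => hk.injective hab)]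
    exact Finset.toFinset_bitIndices_sum_two_pow _
  rw [this]
  refine ⟨Finset.card_image_le.trans (by simpa using hs), ?_⟩
  intro i hi
  obtain ⟨j, _, rfl⟩ := Finset.mem_image.1 hi
  exact hk1 j

lemma poly_rep {l : ℕ} (m : ℕ → ℕ) (hminj : Function.Injective m)
    (hmr : ∀ k, m k ∈ DyadicStar l) (b : ℕ → ℝ) (hb : (Function.support b).Finite) (k0 : ℕ) :
    ∃ (U : Finset ℕ) (c : Finset ℕ → ℝ), (∀ k ∈ U, 1 ≤ k) ∧ (∀ S, l < S.card → c S = 0) ∧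
      b k0 ^ 2 ≤ qSum U c ∧ ∀ x, ∑ᶠ k, b k * walsh (m k) x = rPoly U c x := by
  classical
  set K : Finset ℕ := insert k0 hb.toFinset with hK
  set U : Finset ℕ := K.biUnion fun k => bitSet (m k) with hUdef
  have hsub : ∀ k ∈ K, bitSet (m k) ∈ U.powerset := fun k hk =>
    Finset.mem_powerset.2 (Finset.subset_biUnion_of_mem (fun k => bitSet (m k)) hk)
  set c : Finset ℕ → ℝ := fun S => ∑ k ∈ K, if bitSet (m k) = S then b k else 0 with hc
  refine ⟨U, c, ?_, ?_, ?_, ?_⟩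
  · intro k hk
    obtain ⟨j, _, hj⟩ := Finset.mem_biUnion.1 hk
    exact (bitSet_star (hmr j)).2 k hj
  · intro S hS
    refine Finset.sum_eq_zero fun k _ => ?_
    rw [if_neg]
    rintro rfl
    exact absurd (bitSet_star (hmr k)).1 (by omega)
  · have hk0 : k0 ∈ K := Finset.mem_insert_self _ _
    have : c (bitSet (m k0)) = b k0 := by
      simp only [hc]
      rw [Finset.sum_eq_single_of_mem k0 hk0]
      · simp
      · intro k _ hk
        exact if_neg fun h => hk (hminj (bitSet_inj h))
    rw [← this]
    exact Finset.single_le_sum (f := fun S => c S ^ 2) (fun _ _ => sq_nonneg _) (hsub k0 hk0)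
  · intro x
    rw [finsum_eq_sum_of_support_subset (s := K)]
    · unfold rPoly
      simp only [hc, Finset.sum_mul]
      rw [Finset.sum_comm]
      refine Finset.sum_congr rfl fun k hk => ?_
      rw [Finset.sum_eq_single_of_mem _ (hsub k hk)]
      · simp [walsh_eq]
      · intro S _ hS
        rw [if_neg (Ne.symm hS), zero_mul]
    · intro k hk
      have : b k ≠ 0 := left_ne_zero_of_mul hk
      simp [hK, this]

/-- **Theorem 5.** Let `l ≥ 2`, let `{m_k}` be an enumeration of `D*(l)` and let
`T = {t_{n,k}}` be a summation method. If the sums `∑_k t_{n,k} a_k w_{m_k}(x)` converge to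
zero as `n → ∞` on a measurable set `E ⊆ (0,1)` of measure `|E| > 1 - 2^{-4l}`, then
`a_k = 0` for all `k`. -/
theorem statement11 (l : ℕ) (hl : 2 ≤ l)
    (m : ℕ → ℕ) (hminj : Function.Injective m) (hmr : Set.range m = DyadicStar l)
    (t : ℕ → ℕ → ℝ) (M : ℝ)
    (ht1 : ∀ i, (Function.support (t i)).Finite)
    (ht2 : ∀ i k, |t i k| ≤ M)
    (ht3 : ∀ k, Tendsto (fun i => t i k) atTop (𝓝 1))
    (a : ℕ → ℝ) (E : Set ℝ) (hE : MeasurableSet E) (hE1 : E ⊆ Set.Ioo 0 1)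
    (hEm : ENNReal.ofReal (1 - 1 / 2 ^ (4 * l)) < volume E)
    (hz : ∀ x ∈ E, Tendsto (fun i => ∑ᶠ k, t i k * a k * walsh (m k) x) atTop (𝓝 0)) :
    ∀ k, a k = 0 := by
  intro k0
  have hrep := fun i => poly_rep m hminj (fun k => hmr ▸ Set.mem_range_self k)
    (fun k => t i k * a k)
    ((ht1 i).subset fun k hk => left_ne_zero_of_mul (Function.mem_support.1 hk)) k0
  choose U c hU hc hq hP using hrep
  simp only [hP] at hz
  have hEI : muI E = volume E :=
    Measure.restrict_eq_self _ (hE1.trans Set.Ioo_subset_Ioc_self)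
  have hEr : 1 - 1 / 16 ^ l < muI.real E := by
    have h := (ENNReal.ofReal_lt_iff_lt_toReal ?_ ?_).1 (hEI ▸ hEm)
    · rw [pow_mul] at h
      norm_num at h ⊢
      exact h
    · have : (1:ℝ) / 2 ^ (4 * l) ≤ 1 := by
        rw [div_le_one (by positivity)]
        exact one_le_pow₀ (by norm_num)
      linarith
    · exact measure_ne_top _ _
  have htm : TendstoInMeasure (muI.restrict E) (fun i => rPoly (U i) (c i)) atTop
      (fun _ => (0:ℝ)) := by
    apply tendstoInMeasure_of_tendsto_ae
    · intro i
      exact (rPoly_bm _ _).1.aestronglyMeasurable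
    · filter_upwards [ae_restrict_mem hE] with x hx using hz x hx
  rw [tendstoInMeasure_iff_measureReal_norm] at htm
  have key : ∀ ε : ℝ, 0 < ε → a k0 ^ 2 ≤ 16 / 7 * ε ^ 2 := by
    intro ε hε
    have h1 := htm ε hε
    have h2 : ∀ᶠ i in atTop, (t i k0 * a k0) ^ 2 ≤ 16 / 7 * ε ^ 2 := by
      filter_upwards [h1.eventually_lt_const (sub_pos.2 hEr)] with i hi
      refine (hq i).trans ?_
      have hF : MeasurableSet {x | ε ≤ ‖rPoly (U i) (c i) x - 0‖} :=
        measurableSet_le measurable_const (((rPoly_bm _ _).1.sub measurable_const).norm)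
      refine small_q (hU i) hl (c i) (hc i) (by positivity) hF ?_ ?_
      · rw [measureReal_restrict_apply hF] at hi
        have h3 := measureReal_diff_add_inter (μ := muI) hE
          (s := {x | ε ≤ ‖rPoly (U i) (c i) x - 0‖})
        have h4 : muI.real ({x | ε ≤ ‖rPoly (U i) (c i) x - 0‖} \ E) ≤ muI.real Eᶜ :=
          measureReal_mono fun x hx => hx.2
        rw [measureReal_compl hE, muI_one] at h4
        linarith
      · intro x hx
        simp only [Set.mem_setOf_eq, not_le, sub_zero, Real.norm_eq_abs] at hx
        rw [← sq_abs]
        exact pow_le_pow_left₀ (abs_nonneg _) hx.le 2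
    have h3 : Tendsto (fun i => (t i k0 * a k0) ^ 2) atTop (𝓝 ((1 * a k0) ^ 2)) :=
      ((ht3 k0).mul_const _).pow 2
    rw [one_mul] at h3
    exact le_of_tendsto h3 h2
  by_contra h
  have hp : 0 < |a k0| := abs_pos.2 h
  have := key (|a k0| / 2) (by positivity)
  rw [div_pow, sq_abs] at this
  have : 0 < a k0 ^ 2 := by positivity
  linarith
end
end

section
/- Let l ≥ 2 be an integer, let λ_{l+1} be the unique solution x > 1 of x^{l} = x^{l-1} + ... + x + 1, and let {n_k} be a λ-lacunary sequence of positive integers with λ > λ_{l+1}. Then every integer m admits at most one representation of the form m = n_{j_1} + n_{j_2} + ... + n_{j_s} with j_1 > j_2 > ... > j_s and 1 ≤ s ≤ l (uniqueness holds for the length s and the indices simultaneously). -/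
open MeasureTheory Filter Finset Topology

noncomputable section

/-- A sequence of positive integers is `lam`-lacunary if `n (k+1) / n k > lam` for all `k`. -/
def IsLacunary (lam : ℝ) (n : ℕ → ℕ) : Prop :=
  (∀ k, 0 < n k) ∧ ∀ k, lam * (n k : ℝ) < (n (k + 1) : ℝ)

theorem aux18 (x : ℝ) (hx : 1 < x) (n : ℕ → ℕ) (hp : ∀ k, 0 < n k)
    (hs : ∀ k, x * (n k : ℝ) < (n (k + 1) : ℝ)) (hm : Monotone n) (s : ℕ) :
    ∀ (k : ℕ) (B : Finset ℕ), (∀ i ∈ B, i < k) → B.card ≤ s →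
      (∑ i ∈ B, (n i : ℝ)) * x ^ s ≤ n k * ∑ i ∈ Finset.range s, x ^ i ∧
      (0 < s → (∑ i ∈ B, (n i : ℝ)) * x ^ s < n k * ∑ i ∈ Finset.range s, x ^ i) := by
  have hx0 : 0 < x := by linarith
  induction s with
  | zero =>
    intro k B hB hc
    have : B = ∅ := Finset.card_eq_zero.mp (by omega)
    subst this
    simp
  | succ s ih =>
    intro k B hB hc
    have hG : 0 < ∑ i ∈ Finset.range (s + 1), x ^ i :=
      Finset.sum_pos (fun i _ => pow_pos hx0 i) ⟨0, by simp⟩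
    have hk : (0 : ℝ) < n k := by exact_mod_cast hp k
    suffices h : (∑ i ∈ B, (n i : ℝ)) * x ^ (s + 1)
        < n k * ∑ i ∈ Finset.range (s + 1), x ^ i from ⟨h.le, fun _ => h⟩
    rcases B.eq_empty_or_nonempty with rfl | hne
    · simpa using mul_pos hk hG
    · have hmem := B.max'_mem hne
      set m := B.max' hne with hmdef
      have h1 := (ih m (B.erase m) (fun i hi => by
        have := B.le_max' i (Finset.mem_of_mem_erase hi)
        have h3 := Finset.ne_of_mem_erase hi
        omega) (by rw [Finset.card_erase_of_mem hmem]; omega)).1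
      rw [← Finset.add_sum_erase B _ hmem]
      have h2 : x * (n m : ℝ) < n k := lt_of_lt_of_le (hs m) (by exact_mod_cast hm (hB m hmem))
      calc ((n m : ℝ) + ∑ i ∈ B.erase m, (n i : ℝ)) * x ^ (s + 1)
          = x * (n m * x ^ s + (∑ i ∈ B.erase m, (n i : ℝ)) * x ^ s) := by ring
        _ ≤ x * (n m * x ^ s + n m * ∑ i ∈ Finset.range s, x ^ i) := by gcongr
        _ = (x * n m) * ∑ i ∈ Finset.range (s + 1), x ^ i := by
            rw [Finset.sum_range_succ]; ring
        _ < _ := mul_lt_mul_of_pos_right h2 hG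

/-- **Property (P3).** Let `l ≥ 2` and let `{n_k}` be `λ`-lacunary with `λ > λ_{l+1}`, where
`λ_{l+1} > 1` solves `x^l = x^{l-1} + ⋯ + x + 1`. Then every integer admits at most one
representation `n_{j₁} + ⋯ + n_{j_s}` with `j₁ > ⋯ > j_s` and `1 ≤ s ≤ l` (the set of
indices, hence also the length `s`, is unique). A representation is encoded by its set of
indices, a `Finset ℕ` of cardinality between `1` and `l`. -/
theorem statement18 (l : ℕ) (hl : 2 ≤ l)
    (laml : ℝ) (hlaml : 1 < laml)
    (hlameq : laml ^ l = ∑ i ∈ Finset.range l, laml ^ i)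
    (lam : ℝ) (hlam : laml < lam)
    (n : ℕ → ℕ) (hn : IsLacunary lam n) :
    ∀ A B : Finset ℕ, 1 ≤ A.card → A.card ≤ l → 1 ≤ B.card → B.card ≤ l →
      ∑ i ∈ A, n i = ∑ i ∈ B, n i → A = B := by
  intro A B _ hA _ hB hsum
  obtain ⟨hp, hs⟩ := hn
  have hs' : ∀ k, laml * (n k : ℝ) < (n (k + 1) : ℝ) := fun k =>
    lt_of_le_of_lt (mul_le_mul_of_nonneg_right hlam.le (Nat.cast_nonneg _)) (hs k)
  have hm : Monotone n := monotone_nat_of_le_succ fun k => by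
    have h1 := hs' k
    have h2 : (0 : ℝ) ≤ n k := Nat.cast_nonneg _
    have : (n k : ℝ) ≤ n (k + 1) := by nlinarith
    exact_mod_cast this
  have key : ∀ C D : Finset ℕ, D.card ≤ l → ∑ i ∈ C, n i = ∑ i ∈ D, n i →
      ∀ k ∈ C, (∀ i ∈ D, i < k) → False := by
    intro C D hD h k hk hlt
    have h1 := (aux18 laml hlaml n hp hs' hm l k D hlt hD).2 (by omega)
    rw [← hlameq] at h1
    have h2 := lt_of_mul_lt_mul_right h1 (by positivity)
    have h3 : ∑ i ∈ D, n i < n k := by exact_mod_cast h2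
    have h4 : n k ≤ ∑ i ∈ C, n i := Finset.single_le_sum (fun _ _ => Nat.zero_le _) hk
    omega
  have hd : ∑ i ∈ A \ B, n i = ∑ i ∈ B \ A, n i := by
    have h1 := Finset.sum_inter_add_sum_sdiff A B n
    have h2 := Finset.sum_inter_add_sum_sdiff B A n
    rw [Finset.inter_comm] at h2
    omega
  have hcA : (A \ B).card ≤ l := (Finset.card_le_card Finset.sdiff_subset).trans hA
  have hcB : (B \ A).card ≤ l := (Finset.card_le_card Finset.sdiff_subset).trans hB
  by_contra hne
  have hU : ((A \ B) ∪ (B \ A)).Nonempty := by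
    by_contra h
    rw [Finset.not_nonempty_iff_eq_empty, Finset.union_eq_empty, Finset.sdiff_eq_empty_iff_subset,
      Finset.sdiff_eq_empty_iff_subset] at h
    exact hne (Finset.Subset.antisymm h.1 h.2)
  obtain ⟨k, hmem, hle⟩ : ∃ k ∈ (A \ B) ∪ (B \ A), ∀ i ∈ (A \ B) ∪ (B \ A), i ≤ k :=
    ⟨_, Finset.max'_mem _ hU, fun i hi => Finset.le_max' _ i hi⟩
  rcases Finset.mem_union.mp hmem with h | h
  · refine key _ _ hcB hd k h fun i hi => lt_of_le_of_ne (hle i (Finset.mem_union_right _ hi)) ?_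
    rintro rfl
    simp only [Finset.mem_sdiff] at h hi
    exact h.2 hi.1
  · refine key _ _ hcA hd.symm k h fun i hi =>
      lt_of_le_of_ne (hle i (Finset.mem_union_left _ hi)) ?_
    rintro rfl
    simp only [Finset.mem_sdiff] at h hi
    exact h.2 hi.1
end
end
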